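/- arXiv:1504.04845 — 2 statements merged into one kernel-verified Lean document; each statement's English description precedes it below -/
import Mathlib

section
/- Let f : ℝ³ → ℝ be continuous and Y-periodic, where Y = [0,1]³. Then for every g ∈ L¹(D), lim_{ε→0} ∫_D f(x/ε) g(x) dx = (∫_Y f(y) dy) · (∫_D g(x) dx); that is, the functions x ↦ f(x/ε) converge weakly-* in L^∞(D) to the constant ∫_Y f(y) dy as ε → 0. -/
open MeasureTheory Filter
open scoped ENNReal

noncomputable section

abbrev E3 := EuclideanSpace ℝ (Fin 3)

/-- The unit cube Y = [0,1]³. -/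
def Ycube : Set E3 := {y : E3 | ∀ i : Fin 3, y i ∈ Set.Icc (0 : ℝ) 1}

section PeriodicHomogenization

open Topology

variable {ι : Type*}

/-- The covering map from Euclidean space to the unit torus. -/
def torusMk (ι : Type*) : C(EuclideanSpace ℝ ι, UnitAddTorus ι) where
  toFun x i := (x i : UnitAddCircle)
  continuous_toFun := by
    refine continuous_pi fun i => ?_
    exact (AddCircle.continuous_mk' 1).comp (by fun_prop)

lemma isOpenQuotientMap_torusMk : IsOpenQuotientMap (torusMk ι) := by
  have hpi : IsOpenQuotientMap
      (Pi.map fun (_ : ι) (t : ℝ) => (t : UnitAddCircle)) :=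
    .piMap fun _ => QuotientAddGroup.isOpenQuotientMap_mk
  exact hpi.comp (PiLp.homeomorph 2 fun _ : ι => ℝ).isOpenQuotientMap

/-- A continuous function that is invariant under integer translations factors through the
torus. -/
lemma exists_comp_torusMk_eq {X : Type*} [TopologicalSpace X] {f : EuclideanSpace ℝ ι → X}
    (hf : Continuous f)
    (hper : ∀ (y : EuclideanSpace ℝ ι) (k : ι → ℤ), f (y + WithLp.toLp 2 fun i => (k i : ℝ)) = f y) :
    ∃ F : C(UnitAddTorus ι, X), ∀ x, F (torusMk ι x) = f x := by
  have hfac : Function.FactorsThrough f (torusMk ι) := by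
    intro x y hxy
    have hk : ∀ i, ∃ k : ℤ, (k : ℝ) = x i - y i := by
      intro i
      have hi : ((x i : ℝ) : UnitAddCircle) = (y i : ℝ) := congrFun hxy i
      rw [← sub_eq_zero, ← AddCircle.coe_sub, AddCircle.coe_eq_zero_iff] at hi
      simpa using hi
    choose k hk using hk
    rw [← hper y k]
    congr 1
    ext i
    simp [hk]
  refine ⟨isOpenQuotientMap_torusMk.isQuotientMap.lift ⟨f, hf⟩ hfac, fun x => ?_⟩
  exact DFunLike.congr_fun
    (isOpenQuotientMap_torusMk.isQuotientMap.lift_comp ⟨f, hf⟩ hfac) x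

/-- Integration of the pullback of a continuous function along `p` against an integrable weight. -/
def pullbackIntegralCLM {V X : Type*} [TopologicalSpace V] [MeasurableSpace V]
    [OpensMeasurableSpace V] [TopologicalSpace X] [CompactSpace X] {μ : Measure V} {w : V → ℂ}
    (hw : Integrable w μ) (p : C(V, X)) : C(X, ℂ) →L[ℂ] ℂ :=
  have hint (F : C(X, ℂ)) : Integrable (fun v => F (p v) * w v) μ :=
    hw.bdd_mul (c := ‖F‖) (F.comp p).continuous.aestronglyMeasurable
      (.of_forall fun v => F.norm_coe_le_norm (p v))
  LinearMap.mkContinuous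
    { toFun F := ∫ v, F (p v) * w v ∂μ
      map_add' F G := by
        simp only [ContinuousMap.add_apply, add_mul]
        exact integral_add (hint F) (hint G)
      map_smul' c F := by
        simp only [ContinuousMap.smul_apply, smul_eq_mul, mul_assoc, RingHom.id_apply]
        exact integral_const_mul c _ }
    (∫ v, ‖w v‖ ∂μ) fun F => by
      rw [mul_comm, ← integral_const_mul]
      refine norm_integral_le_of_norm_le (hw.norm.const_mul _) (.of_forall fun v => ?_)
      rw [norm_mul]
      exact mul_le_mul_of_nonneg_right (F.norm_coe_le_norm _) (norm_nonneg _)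

lemma pullbackIntegralCLM_apply {V X : Type*} [TopologicalSpace V] [MeasurableSpace V]
    [OpensMeasurableSpace V] [TopologicalSpace X] [CompactSpace X] {μ : Measure V} {w : V → ℂ}
    (hw : Integrable w μ) (p : C(V, X)) (F : C(X, ℂ)) :
    pullbackIntegralCLM hw p F = ∫ v, F (p v) * w v ∂μ := rfl

lemma norm_pullbackIntegralCLM_le {V X : Type*} [TopologicalSpace V] [MeasurableSpace V]
    [OpensMeasurableSpace V] [TopologicalSpace X] [CompactSpace X] {μ : Measure V} {w : V → ℂ}
    (hw : Integrable w μ) (p : C(V, X)) :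
    ‖pullbackIntegralCLM hw p‖ ≤ ∫ v, ‖w v‖ ∂μ :=
  by
  unfold pullbackIntegralCLM
  exact LinearMap.mkContinuous_norm_le _ (integral_nonneg fun _ => norm_nonneg _) _

/-- For a uniformly bounded family of functionals, convergence needs to be checked only on a set
with dense span. -/
lemma tendsto_apply_of_dense_span {α E : Type*} [NormedAddCommGroup E] [NormedSpace ℂ E]
    {l : Filter α} {L : α → E →L[ℂ] ℂ} {L₀ : E →L[ℂ] ℂ} {C : ℝ} (hL : ∀ a, ‖L a‖ ≤ C)
    {s : Set E} (hs : (Submodule.span ℂ s).topologicalClosure = ⊤)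
    (h : ∀ x ∈ s, Tendsto (fun a => L a x) l (𝓝 (L₀ x))) (x : E) :
    Tendsto (fun a => L a x) l (𝓝 (L₀ x)) := by
  let S : Submodule ℂ E :=
    { carrier := {x | Tendsto (fun a => L a x) l (𝓝 (L₀ x))}
      add_mem' := fun hx hy => by
        simpa only [Set.mem_ofPred_eq, map_add] using hx.add hy
      zero_mem' := by simpa using tendsto_const_nhds
      smul_mem' := fun c x hx => by
        simpa only [Set.mem_ofPred_eq, map_smul] using hx.const_smul c }
  have hequi : Equicontinuous fun a => (L a : E → ℂ) := by
    refine (Metric.uniformEquicontinuous_of_continuity_modulus (fun t => C * t) ?_ _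
      fun x y a => ?_).equicontinuous
    · simpa using (tendsto_id (x := 𝓝 (0 : ℝ))).const_mul C
    · rw [dist_eq_norm, dist_eq_norm, ← map_sub]
      exact (L a).le_of_opNorm_le (hL a) _
  have hclosed : IsClosed (S : Set E) := hequi.isClosed_setOfPred_tendsto L₀.continuous
  have hle : (Submodule.span ℂ s).topologicalClosure ≤ S :=
    Submodule.topologicalClosure_minimal _ (Submodule.span_le.2 h) hclosed
  exact hle (hs ▸ Submodule.mem_top)

lemma unitCube_eq_preimage :
    {y : EuclideanSpace ℝ ι | ∀ i, y i ∈ Set.Icc (0 : ℝ) 1} =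
      WithLp.ofLp ⁻¹' Set.univ.pi fun _ => Set.Icc (0 : ℝ) 1 := by
  ext y
  simp only [Set.mem_ofPred_eq, Set.mem_preimage, Set.mem_pi, Set.mem_univ, true_imp_iff]

variable [Fintype ι]

lemma mFourier_torusMk (n : ι → ℤ) (x : EuclideanSpace ℝ ι) :
    UnitAddTorus.mFourier n (torusMk ι x) =
      Real.fourierChar (inner ℝ x (WithLp.toLp 2 fun i => (n i : ℝ))) := by
  simp only [UnitAddTorus.mFourier, torusMk, ContinuousMap.coe_mk, fourier_coe_apply,
    Real.fourierChar_apply, ← Complex.exp_sum, PiLp.inner_apply]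
  congr 1
  push_cast
  rw [Finset.mul_sum, Finset.sum_mul]
  refine Finset.sum_congr rfl fun i _ => ?_
  simp
  ring

lemma integral_Icc_fourier {n : ℤ} (hn : n ≠ 0) :
    ∫ t in Set.Icc (0 : ℝ) 1, fourier n (t : UnitAddCircle) = 0 := by
  have hc : 2 * (Real.pi : ℂ) * Complex.I * n ≠ 0 := by
    simp [hn, Real.pi_ne_zero]
  rw [integral_Icc_eq_integral_Ioc, ← intervalIntegral.integral_of_le zero_le_one]
  simp only [fourier_coe_apply, Complex.ofReal_one, div_one]
  rw [integral_exp_mul_complex hc]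
  have h1 : Complex.exp (2 * (Real.pi : ℂ) * Complex.I * n) = 1 :=
    Complex.exp_eq_one_iff.2 ⟨n, by ring⟩
  simp [h1]

lemma setIntegral_unitCube_comp_ofLp {E : Type*} [NormedAddCommGroup E] [NormedSpace ℝ E]
    (h : (ι → ℝ) → E) :
    ∫ y in {y : EuclideanSpace ℝ ι | ∀ i, y i ∈ Set.Icc (0 : ℝ) 1}, h y.ofLp =
      ∫ y, h y ∂(Measure.pi fun _ : ι => volume.restrict (Set.Icc (0 : ℝ) 1)) := by
  rw [← Measure.restrict_pi_pi, ← volume_pi]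
  rw [unitCube_eq_preimage]
  exact (PiLp.volume_preserving_ofLp ι).setIntegral_preimage_emb
    (MeasurableEquiv.toLp 2 (ι → ℝ)).symm.measurableEmbedding h _

lemma volume_unitCube :
    volume {y : EuclideanSpace ℝ ι | ∀ i, y i ∈ Set.Icc (0 : ℝ) 1} = 1 := by
  rw [unitCube_eq_preimage, (PiLp.volume_preserving_ofLp ι).measure_preimage
    (MeasurableSet.univ_pi fun _ => measurableSet_Icc).nullMeasurableSet, volume_pi_pi]
  simp

lemma setIntegral_unitCube_mFourier {n : ι → ℤ} (hn : n ≠ 0) :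
    ∫ y in {y : EuclideanSpace ℝ ι | ∀ i, y i ∈ Set.Icc (0 : ℝ) 1},
      UnitAddTorus.mFourier n (torusMk ι y) = 0 := by
  obtain ⟨i, hi⟩ := Function.ne_iff.1 hn
  refine (setIntegral_unitCube_comp_ofLp
    fun y : ι → ℝ => ∏ i, fourier (n i) (y i : UnitAddCircle)).trans ?_
  rw [integral_fintype_prod_eq_prod fun i (t : ℝ) => fourier (n i) (t : UnitAddCircle)]
  exact Finset.prod_eq_zero (Finset.mem_univ i) (integral_Icc_fourier hi)

/-- The Riemann-Lebesgue lemma for a rescaled nonconstant Fourier monomial. -/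
lemma tendsto_integral_mFourier_smul {n : ι → ℤ} (hn : n ≠ 0) (g : EuclideanSpace ℝ ι → ℂ) :
    Tendsto (fun ε : ℝ => ∫ x, UnitAddTorus.mFourier n (torusMk ι (ε⁻¹ • x)) * g x)
      (𝓝[>] 0) (𝓝 0) := by
  set v : EuclideanSpace ℝ ι := WithLp.toLp 2 fun i => (n i : ℝ) with hv
  have hv0 : v ≠ 0 := by
    obtain ⟨i, hi⟩ := Function.ne_iff.1 hn
    intro h
    exact hi (by simpa [hv] using congrArg (fun u : EuclideanSpace ℝ ι => u i) h)
  have hfreq : Tendsto (fun ε : ℝ => -(ε⁻¹ • v)) (𝓝[>] 0)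
      (cocompact (EuclideanSpace ℝ ι)) := by
    rw [← Metric.cobounded_eq_cocompact, ← tendsto_norm_atTop_iff_cobounded]
    simp only [norm_neg, norm_smul]
    exact (tendsto_norm_atTop_atTop.comp tendsto_inv_nhdsGT_zero).atTop_mul_const
      (norm_pos_iff.2 hv0)
  refine ((tendsto_integral_exp_inner_smul_cocompact g).comp hfreq).congr fun ε => ?_
  refine integral_congr_ae (.of_forall fun x => ?_)
  simp only [mFourier_torusMk, inner_neg_right, neg_neg, inner_smul_left, inner_smul_right,
    Circle.smul_def, smul_eq_mul, ← hv, conj_trivial]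

lemma tendsto_integral_torus_smul {g : EuclideanSpace ℝ ι → ℂ} (hg : Integrable g)
    (F : C(UnitAddTorus ι, ℂ)) :
    Tendsto (fun ε : ℝ => ∫ x, F (torusMk ι (ε⁻¹ • x)) * g x) (𝓝[>] 0)
      (𝓝 ((∫ y in {y : EuclideanSpace ℝ ι | ∀ i, y i ∈ Set.Icc (0 : ℝ) 1},
        F (torusMk ι y)) * ∫ x, g x)) := by
  set Y : Set (EuclideanSpace ℝ ι) := {y | ∀ i, y i ∈ Set.Icc (0 : ℝ) 1} with hY
  have hone : Integrable (fun _ : EuclideanSpace ℝ ι => (1 : ℂ)) (volume.restrict Y) :=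
    integrableOn_const (by rw [hY, volume_unitCube]; exact ENNReal.one_ne_top)
  let dilate (ε : ℝ) : C(EuclideanSpace ℝ ι, UnitAddTorus ι) :=
    (torusMk ι).comp ⟨fun x => ε⁻¹ • x, by fun_prop⟩
  let L₀ : C(UnitAddTorus ι, ℂ) →L[ℂ] ℂ := (∫ x, g x) • pullbackIntegralCLM hone (torusMk ι)
  have hL₀ (F : C(UnitAddTorus ι, ℂ)) :
      L₀ F = (∫ y in Y, F (torusMk ι y)) * ∫ x, g x := by
    simp [L₀, pullbackIntegralCLM_apply, mul_comm]
  rw [← hL₀]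
  refine tendsto_apply_of_dense_span (L := fun ε => pullbackIntegralCLM hg (dilate ε))
    (fun ε => norm_pullbackIntegralCLM_le hg (dilate ε))
    UnitAddTorus.span_mFourier_closure_eq_top ?_ F
  rintro _ ⟨n, rfl⟩
  rw [hL₀]
  by_cases hn : n = 0
  · subst hn
    have hvol : volume.real Y = 1 := by rw [Measure.real, hY, volume_unitCube, ENNReal.toReal_one]
    simp [pullbackIntegralCLM_apply, UnitAddTorus.mFourier_zero, hvol]
  · rw [setIntegral_unitCube_mFourier hn, zero_mul]
    exact tendsto_integral_mFourier_smul hn g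

end PeriodicHomogenization

/-- If f : ℝ³ → ℝ is continuous and Y-periodic, then for every g ∈ L¹(D),
∫_D f(x/ε) g(x) dx → (∫_Y f(y) dy) (∫_D g(x) dx) as ε → 0⁺: the functions x ↦ f(x/ε)
converge weakly-* in L^∞(D) to the constant ∫_Y f. -/
theorem statement8
    (D : Set E3) (hDmeas : MeasurableSet D) (hDbdd : Bornology.IsBounded D)
    (f : E3 → ℝ) (hfcont : Continuous f)
    (hfper : ∀ (y : E3) (k : Fin 3 → ℤ),
      f (y + (EuclideanSpace.equiv (Fin 3) ℝ).symm (fun i => (k i : ℝ))) = f y)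
    (g : E3 → ℝ) (hg : Integrable g (volume.restrict D)) :
    Tendsto (fun ε : ℝ => ∫ x in D, f (ε⁻¹ • x) * g x)
      (nhdsWithin 0 (Set.Ioi 0))
      (nhds ((∫ y in Ycube, f y) * ∫ x in D, g x)) := by
  obtain ⟨F, hF⟩ := exists_comp_torusMk_eq hfcont hfper
  let G : C(UnitAddTorus (Fin 3), ℂ) := ⟨fun t => (F t : ℂ), by fun_prop⟩
  have hG (x : E3) : G (torusMk (Fin 3) x) = (f x : ℂ) := congrArg Complex.ofReal (hF x)
  have hgD : Integrable (D.indicator fun x => (g x : ℂ)) :=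
    (integrable_indicator_iff hDmeas).2 hg.ofReal
  have hlim := (Complex.continuous_re.tendsto _).comp (tendsto_integral_torus_smul hgD G)
  simp only [hG, integral_indicator hDmeas, integral_complex_ofReal] at hlim
  rw [← Complex.ofReal_mul, Complex.ofReal_re] at hlim
  refine hlim.congr fun ε => ?_
  have hind (x : E3) : (f (ε⁻¹ • x) : ℂ) * D.indicator (fun x => (g x : ℂ)) x =
      D.indicator (fun x => ((f (ε⁻¹ • x) * g x : ℝ) : ℂ)) x := by
    by_cases hx : x ∈ D <;> simp [hx]
  simp only [Function.comp_apply, hind, integral_indicator hDmeas, integral_complex_ofReal,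
    Complex.ofReal_re]
end
end

section
/- Let β : ℝ³ → ℝ be a nonnegative function that is Lipschitz with constant L > 0. Then for all vectors a, b ∈ ℝ³, (β(a) a − β(b) b) · (b − a) ≤ L ‖b‖ ‖b − a‖², where · is the Euclidean inner product and ‖·‖ the Euclidean norm. (This is the pointwise inequality (ᾱ(u₁)u₁ − ᾱ(u₂)u₂)(u₂ − u₁) = −ᾱ(u₁)(u₂−u₁)² + u₂(ᾱ(u₂)−ᾱ(u₁))(u₂−u₁) ≤ C|u₂||u₂−u₁|² used to prove uniqueness for the averaged Brinkman equation.) -/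
open scoped RealInnerProductSpace

noncomputable section

/-- If β : ℝ³ → ℝ is nonnegative and L-Lipschitz, then for all a, b ∈ ℝ³,
(β(a) a − β(b) b) · (b − a) ≤ L ‖b‖ ‖b − a‖². -/
theorem statement9
    (β : E3 → ℝ) (hβpos : ∀ a, 0 ≤ β a)
    (L : ℝ) (hL : 0 < L)
    (hβlip : ∀ a b : E3, |β a - β b| ≤ L * ‖a - b‖)
    (a b : E3) :
    ⟪β a • a - β b • b, b - a⟫ ≤ L * ‖b‖ * ‖b - a‖ ^ 2 := by
  have hdecomp : ⟪β a • a - β b • b, b - a⟫ =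
      -(β a * ‖b - a‖ ^ 2) + (β a - β b) * ⟪b, b - a⟫ := by
    have h : β a • a - β b • b = -(β a • (b - a)) + (β a - β b) • b := by module
    rw [h, inner_add_left, inner_neg_left, real_inner_smul_left, real_inner_smul_left,
      real_inner_self_eq_norm_sq]
  have hcross : (β a - β b) * ⟪b, b - a⟫ ≤ L * ‖b‖ * ‖b - a‖ ^ 2 :=
    calc (β a - β b) * ⟪b, b - a⟫ ≤ |β a - β b| * |⟪b, b - a⟫| := by
          rw [← abs_mul]
          exact le_abs_self _
      _ ≤ (L * ‖b - a‖) * (‖b‖ * ‖b - a‖) := by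
          gcongr
          · rw [norm_sub_rev]
            exact hβlip a b
          · exact abs_real_inner_le_norm b (b - a)
      _ = L * ‖b‖ * ‖b - a‖ ^ 2 := by ring
  have hdiag : 0 ≤ β a * ‖b - a‖ ^ 2 := mul_nonneg (hβpos a) (sq_nonneg _)
  linarith
end
end
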